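/- Let n ≥ 1, 1 ≤ p < ∞, and α > 0. Let A_r be a real positive definite 2n×2n matrix with eigenvalues λ₁, …, λ_{2n} (with multiplicity), and let g_r(x) = e^{−(x, (α/2)·A_r·x)} for x ∈ ℝ^{2n}. Then ‖|Q_α| g_r‖_{L^p(λ)}^p / ‖g_r‖_{L^p(λ)}^p = 2^{np} · ∏_{j=1}^{2n} (1 + λ_j)^{−(p−1)/2}. -/

import Mathlib

open MeasureTheory Complex ENNReal Matrix

/-- The operator `|Q_α|` on functions on `ℝ^{2n} ≅ ℂⁿ` (coordinates indexed by
`Fin n ⊕ Fin n`): the integral operator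
`|Q_α| F(x) = (α/π)ⁿ ∫ e^{−(α/2)|x−y|²} F(y) λ(dy)`, i.e. convolution with `2ⁿ` times
the Gaussian density `γ_{α/2}`. -/
noncomputable def absQR (n : ℕ) (α : ℝ) (F : (Fin n ⊕ Fin n → ℝ) → ℂ)
    (x : Fin n ⊕ Fin n → ℝ) : ℂ :=
  ((α / Real.pi) ^ n : ℝ) *
    ∫ y, (Real.exp (-(α / 2) * ∑ i, (x i - y i) ^ 2) : ℝ) * F y ∂volume

lemma aux_diag {ι : Type*} [Fintype ι] [DecidableEq ι] (A : Matrix ι ι ℝ) (hA : A.IsHermitian) :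
    ∃ V : Matrix ι ι ℝ, Vᵀ * V = 1 ∧ ∀ x : ι → ℝ,
      ∑ i, ∑ j, x i * A i j * x j = ∑ i, hA.eigenvalues i * ((V *ᵥ x) i) ^ 2 := by
  refine ⟨((hA.eigenvectorUnitary : Matrix ι ι ℝ))ᵀ, ?_, ?_⟩
  · rw [Matrix.transpose_transpose]
    have h := Matrix.mem_unitaryGroup_iff.1 hA.eigenvectorUnitary.2
    simpa [Matrix.star_eq_conjTranspose] using h
  · intro x
    have h := hA.spectral_theorem
    rw [Unitary.conjStarAlgAut_apply] at h
    set U : Matrix ι ι ℝ := (hA.eigenvectorUnitary : Matrix ι ι ℝ)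
    have h1 : ∑ i, ∑ j, x i * A i j * x j = x ⬝ᵥ (A *ᵥ x) := by
      simp [dotProduct, mulVec, Finset.mul_sum, mul_assoc]
    rw [h1]
    have h2 : star U = Uᵀ := by simp [Matrix.star_eq_conjTranspose]
    have h3 : A = U * Matrix.diagonal hA.eigenvalues * Uᵀ := by
      rw [← h2]; exact h
    have h4 : A *ᵥ x = U *ᵥ (Matrix.diagonal hA.eigenvalues *ᵥ (Uᵀ *ᵥ x)) := by
      rw [Matrix.mulVec_mulVec, Matrix.mulVec_mulVec, ← h3]
    rw [h4, Matrix.dotProduct_mulVec, ← Matrix.mulVec_transpose]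
    simp only [dotProduct, Matrix.mulVec_diagonal]
    exact Finset.sum_congr rfl fun i _ => by ring

lemma aux_dist {ι : Type*} [Fintype ι] [DecidableEq ι] (V : Matrix ι ι ℝ) (hV : Vᵀ * V = 1)
    (x y : ι → ℝ) : ∑ i, (x i - y i) ^ 2 = ∑ i, ((V *ᵥ x) i - (V *ᵥ y) i) ^ 2 := by
  have h : ∀ z : ι → ℝ, ∑ i, (z i) ^ 2 = ∑ i, ((V *ᵥ z) i) ^ 2 := by
    intro z
    have h1 : (V *ᵥ z) ⬝ᵥ (V *ᵥ z) = z ⬝ᵥ z := by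
      rw [Matrix.dotProduct_mulVec, ← Matrix.mulVec_transpose, Matrix.mulVec_mulVec, hV,
        Matrix.one_mulVec]
    simp only [dotProduct] at h1
    simp only [pow_two]
    exact h1.symm
  have := h (x - y)
  rw [Matrix.mulVec_sub] at this
  simpa using this

lemma aux_mp {ι : Type*} [Fintype ι] [DecidableEq ι] (V : Matrix ι ι ℝ) (hV : Vᵀ * V = 1) :
    MeasurePreserving (fun x : ι → ℝ => V *ᵥ x) volume volume ∧
    MeasurableEmbedding (fun x : ι → ℝ => V *ᵥ x) := by
  have hd : V.det * V.det = 1 := by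
    have := congrArg Matrix.det hV
    simpa using this
  have hd0 : V.det ≠ 0 := by
    intro h; simp [h] at hd
  have habs : |V.det⁻¹| = 1 := by
    rw [abs_inv]
    have : |V.det| = 1 := by
      rcases mul_self_eq_one_iff.1 hd with h | h <;> simp [h]
    simp [this]
  have hc : Continuous (fun x : ι → ℝ => V *ᵥ x) := by fun_prop
  refine ⟨⟨hc.measurable, ?_⟩, ?_⟩
  · have := Real.map_matrix_volume_pi_eq_smul_volume_pi hd0
    rw [habs, ENNReal.ofReal_one, one_smul] at this
    exact this
  · have hinj : Function.Injective (fun x : ι → ℝ => V *ᵥ x) := by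
      intro x y hxy
      have := congrArg (fun z => Vᵀ *ᵥ z) hxy
      simpa [Matrix.mulVec_mulVec, hV] using this
    exact hc.measurableEmbedding hinj

lemma aux_one {a l : ℝ} (x : ℝ) (hl : 0 < l) :
    ∫ y : ℝ, Real.exp (-a * ((x - y) ^ 2 + l * y ^ 2)) =
      Real.exp (-(a * (l / (1 + l))) * x ^ 2) * Real.sqrt (Real.pi / (a * (1 + l))) := by
  rw [← integral_gaussian, ← integral_const_mul,
    ← integral_add_right_eq_self _ (x / (1 + l))]
  congr 1
  ext y
  rw [← Real.exp_add]
  congr 1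
  have : 1 + l ≠ 0 := by positivity
  field_simp
  ring

lemma aux_norm {ι : Type*} [Fintype ι] (C p : ℝ) (hC : 0 ≤ C) (hp : 1 ≤ p) (b : ι → ℝ)
    (hb : ∀ i, 0 < b i) :
    (eLpNorm (fun x : ι → ℝ => ((C * ∏ i, Real.exp (-(b i) * x i ^ 2) : ℝ) : ℂ))
      (ENNReal.ofReal p) volume).toReal ^ p = C ^ p * ∏ i, Real.sqrt (Real.pi / (p * b i)) := by
  have hp0 : 0 < p := by linarith
  have h0 : ENNReal.ofReal p ≠ 0 := by simpa using hp0
  have ht : (ENNReal.ofReal p).toReal = p := ENNReal.toReal_ofReal hp0.le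
  have hfun : ∀ x : ι → ℝ, ‖((C * ∏ i, Real.exp (-(b i) * x i ^ 2) : ℝ) : ℂ)‖ ^ p =
      C ^ p * ∏ i, Real.exp (-(p * b i) * x i ^ 2) := by
    intro x
    have hq : 0 ≤ ∏ i, Real.exp (-(b i) * x i ^ 2) :=
      Finset.prod_nonneg fun i _ => (Real.exp_pos _).le
    rw [Complex.norm_real, Real.norm_of_nonneg (mul_nonneg hC hq), Real.mul_rpow hC hq,
      ← Real.finsetProd_rpow _ _ (fun i _ => (Real.exp_pos _).le)]
    congr 1
    refine Finset.prod_congr rfl fun i _ => ?_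
    rw [← Real.exp_mul]
    congr 1
    ring
  have hint : Integrable (fun x : ι → ℝ => C ^ p * ∏ i, Real.exp (-(p * b i) * x i ^ 2)) :=
    (Integrable.fintype_prod (f := fun i (t : ℝ) => Real.exp (-(p * b i) * t ^ 2))
      (fun i => integrable_exp_neg_mul_sq (mul_pos hp0 (hb i)))).const_mul _
  have hmem : MemLp (fun x : ι → ℝ => ((C * ∏ i, Real.exp (-(b i) * x i ^ 2) : ℝ) : ℂ))
      (ENNReal.ofReal p) volume := by
    rw [← integrable_norm_rpow_iff _ h0 ENNReal.ofReal_ne_top, ht]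
    · simpa only [hfun] using hint
    · exact Continuous.aestronglyMeasurable (by fun_prop)
  rw [hmem.eLpNorm_eq_integral_rpow_norm h0 ENNReal.ofReal_ne_top, ht]
  have hI : 0 ≤ ∫ x : ι → ℝ, ‖((C * ∏ i, Real.exp (-(b i) * x i ^ 2) : ℝ) : ℂ)‖ ^ p :=
    integral_nonneg fun x => by positivity
  rw [ENNReal.toReal_ofReal (by positivity), ← Real.rpow_mul hI, inv_mul_cancel₀ hp0.ne',
    Real.rpow_one]
  simp only [hfun]
  rw [integral_const_mul,
    integral_fintype_prod_volume_eq_prod (fun i (t : ℝ) => Real.exp (-(p * b i) * t ^ 2))]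
  simp only [integral_gaussian]

theorem absQR_gaussian_ratio (n : ℕ) (hn : 1 ≤ n) (p : ℝ) (hp : 1 ≤ p) (α : ℝ)
    (hα : 0 < α) (Ar : Matrix (Fin n ⊕ Fin n) (Fin n ⊕ Fin n) ℝ)
    (hherm : Ar.IsHermitian) (hpos : Ar.PosDef) :
    (eLpNorm (absQR n α fun x =>
          ((Real.exp (-(α / 2) * ∑ i, ∑ j, x i * Ar i j * x j) : ℝ) : ℂ))
        (ENNReal.ofReal p) volume).toReal ^ p /
      (eLpNorm (fun x : Fin n ⊕ Fin n → ℝ =>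
          ((Real.exp (-(α / 2) * ∑ i, ∑ j, x i * Ar i j * x j) : ℝ) : ℂ))
        (ENNReal.ofReal p) volume).toReal ^ p =
    2 ^ ((n : ℝ) * p) *
      ∏ j, Real.sqrt (1 / (1 + hherm.eigenvalues j) ^ (p - 1)) := by
  have hl : ∀ i, 0 < hherm.eigenvalues i := fun i => hpos.eigenvalues_pos i
  obtain ⟨V, hV, hq⟩ := aux_diag Ar hherm
  obtain ⟨hmp, hme⟩ := aux_mp V hV
  set l := hherm.eigenvalues with hldef
  have hp0 : 0 < p := by linarith
  have hg : (fun x : Fin n ⊕ Fin n → ℝ =>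
      ((Real.exp (-(α / 2) * ∑ i, ∑ j, x i * Ar i j * x j) : ℝ) : ℂ)) =
      (fun x : Fin n ⊕ Fin n → ℝ =>
        (((1 : ℝ) * ∏ i, Real.exp (-(α / 2 * l i) * x i ^ 2) : ℝ) : ℂ)) ∘ (fun x => V *ᵥ x) := by
    ext x
    simp only [Function.comp]
    rw [hq, one_mul, ← Real.exp_sum, Finset.mul_sum]
    congr 3
    ext i
    ring
  set K : ℝ := (α / Real.pi) ^ n * ∏ i, Real.sqrt (Real.pi / (α / 2 * (1 + l i))) with hK
  have hQ : (absQR n α fun x =>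
      ((Real.exp (-(α / 2) * ∑ i, ∑ j, x i * Ar i j * x j) : ℝ) : ℂ)) =
      (fun x : Fin n ⊕ Fin n → ℝ =>
        ((K * ∏ i, Real.exp (-(α / 2 * (l i / (1 + l i))) * x i ^ 2) : ℝ) : ℂ)) ∘
          (fun x => V *ᵥ x) := by
    ext x
    simp only [Function.comp, absQR]
    have h1 : ∀ y : Fin n ⊕ Fin n → ℝ,
        ((Real.exp (-(α / 2) * ∑ i, (x i - y i) ^ 2) : ℝ) : ℂ) *
          ((Real.exp (-(α / 2) * ∑ i, ∑ j, y i * Ar i j * y j) : ℝ) : ℂ) =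
        (fun z : Fin n ⊕ Fin n → ℝ => ((∏ i, Real.exp (-(α / 2) *
          (((V *ᵥ x) i - z i) ^ 2 + l i * z i ^ 2)) : ℝ) : ℂ)) (V *ᵥ y) := by
      intro y
      rw [hq, aux_dist V hV, ← Complex.ofReal_mul, ← Real.exp_add, ← mul_add,
        ← Finset.sum_add_distrib, Finset.mul_sum, Real.exp_sum]
    simp only [h1]
    rw [hmp.integral_comp hme (fun z : Fin n ⊕ Fin n → ℝ => ((∏ i, Real.exp (-(α / 2) *
          (((V *ᵥ x) i - z i) ^ 2 + l i * z i ^ 2)) : ℝ) : ℂ)), integral_complex_ofReal,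
      integral_fintype_prod_volume_eq_prod (fun i (t : ℝ) => Real.exp (-(α / 2) *
          (((V *ᵥ x) i - t) ^ 2 + l i * t ^ 2)))]
    simp only [aux_one _ (hl _)]
    rw [Finset.prod_mul_distrib, ← Complex.ofReal_mul, hK]
    congr 1
    ring
  have hKv : K = 2 ^ n * ∏ i, Real.sqrt (1 / (1 + l i)) := by
    have h2 : ∀ i, Real.sqrt (Real.pi / (α / 2 * (1 + l i))) =
        Real.sqrt (2 * Real.pi / α) * Real.sqrt (1 / (1 + l i)) := by
      intro i
      rw [← Real.sqrt_mul (by positivity)]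
      congr 1
      have := hl i
      field_simp
    rw [hK]
    simp only [h2]
    rw [Finset.prod_mul_distrib, Finset.prod_const, Finset.card_univ, Fintype.card_sum,
      Fintype.card_fin, ← two_mul, pow_mul, Real.sq_sqrt (by positivity), ← mul_assoc, ← mul_pow]
    congr 2
    have := Real.pi_pos
    field_simp
  have hK0 : 0 ≤ K := by rw [hKv]; positivity
  rw [hQ, hg, eLpNorm_comp_measurePreserving (Continuous.aestronglyMeasurable (by fun_prop)) hmp,
    eLpNorm_comp_measurePreserving (Continuous.aestronglyMeasurable (by fun_prop)) hmp,
    aux_norm K p hK0 hp _ (fun i => by have := hl i; positivity),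
    aux_norm 1 p zero_le_one hp _ (fun i => by have := hl i; positivity), Real.one_rpow, one_mul,
    mul_div_assoc, ← Finset.prod_div_distrib, hKv, Real.mul_rpow (by positivity) (by positivity),
    ← Real.finsetProd_rpow _ _ (fun i _ => Real.sqrt_nonneg _), mul_assoc,
    ← Finset.prod_mul_distrib, Real.rpow_mul (by norm_num), Real.rpow_natCast]
  congr 1
  refine Finset.prod_congr rfl fun i _ => ?_
  have hi := hl i
  have h1 : 0 < 1 + l i := by positivity
  have hpi := Real.pi_pos
  rw [← Real.sqrt_div (by positivity)]
  have e1 : Real.pi / (p * (α / 2 * (l i / (1 + l i)))) / (Real.pi / (p * (α / 2 * l i))) =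
      1 + l i := by
    field_simp
  rw [e1, Real.sqrt_eq_rpow, Real.sqrt_eq_rpow, Real.sqrt_eq_rpow, one_div (1 + l i),
    one_div ((1 + l i) ^ (p - 1)), ← Real.rpow_neg_one, ← Real.rpow_neg h1.le,
    ← Real.rpow_mul h1.le, ← Real.rpow_mul h1.le, ← Real.rpow_mul h1.le, ← Real.rpow_add h1]
  congr 1
  ring
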